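/- arXiv:2009.03500 — 4 statements merged into one kernel-verified Lean document; each statement's English description precedes it below -/
import Mathlib

section
/- The set 𝓑_{FS} = 𝓔 ∩ 𝓟 ∩ {p : 2Y₂ = Y₃ and X₂ = X₃} is forward flow-invariant for the Einstein vector field: if c : I → ℝ⁶ is a solution of c'(η) = V(c(η)) on an interval I, η₀, η₁ ∈ I with η₀ ≤ η₁, and c(η₀) ∈ 𝓑_{FS}, then c(η₁) ∈ 𝓑_{FS}. -/
open Real Set Filter

noncomputable section

/-- The quadratic form `G(p) = X₁² + 2X₂² + 4m X₃²`. -/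
def G (m : ℕ) (p : Fin 6 → ℝ) : ℝ := (p 0)^2 + 2*(p 1)^2 + 4*(m:ℝ)*(p 2)^2

/-- `R₁(p) = (1/2)Y₁²Y₂² + (m/4)Y₁²Y₃²`. -/
def R1 (m : ℕ) (p : Fin 6 → ℝ) : ℝ := (1/2)*(p 3)^2*(p 4)^2 + ((m:ℝ)/4)*(p 3)^2*(p 5)^2

/-- `R₂(p) = 2Y₂² − (1/2)Y₁²Y₂² + (m/2)Y₃²`. -/
def R2 (m : ℕ) (p : Fin 6 → ℝ) : ℝ := 2*(p 4)^2 - (1/2)*(p 3)^2*(p 4)^2 + ((m:ℝ)/2)*(p 5)^2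

/-- `R₃(p) = (m+2)Y₂Y₃ − (1/8)Y₁²Y₃² − (1/2)Y₃²`. -/
def R3 (m : ℕ) (p : Fin 6 → ℝ) : ℝ :=
  ((m:ℝ)+2)*(p 4)*(p 5) - (1/8)*(p 3)^2*(p 5)^2 - (1/2)*(p 5)^2

/-- `R_s = R₁ + 2R₂ + 4m R₃`. -/
def Rs (m : ℕ) (p : Fin 6 → ℝ) : ℝ := R1 m p + 2*R2 m p + 4*(m:ℝ)*R3 m p

/-- `L = (G + R_s − 1)/(4m+2)`. -/
def L (m : ℕ) (p : Fin 6 → ℝ) : ℝ := (G m p + Rs m p - 1)/(4*(m:ℝ)+2)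

/-- The Einstein vector field. -/
def V (m : ℕ) (p : Fin 6 → ℝ) : Fin 6 → ℝ :=
  ![ p 0 * (G m p + L m p - 1) + R1 m p - L m p,
     p 1 * (G m p + L m p - 1) + R2 m p - L m p,
     p 2 * (G m p + L m p - 1) + R3 m p - L m p,
     p 3 * (p 0 - p 1),
     p 4 * (G m p + L m p - p 1),
     p 5 * (G m p + L m p + p 1 - 2*p 2) ]

/-- `𝓔 = {p : X₁+2X₂+4m X₃ = 1 and G + R_s ≤ 1}`. -/
def setE (m : ℕ) : Set (Fin 6 → ℝ) :=
  {p | p 0 + 2*p 1 + 4*(m:ℝ)*p 2 = 1 ∧ G m p + Rs m p ≤ 1}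

/-- `∂𝓔 = {p : X₁+2X₂+4m X₃ = 1 and G + R_s = 1}`. -/
def bdryE (m : ℕ) : Set (Fin 6 → ℝ) :=
  {p | p 0 + 2*p 1 + 4*(m:ℝ)*p 2 = 1 ∧ G m p + Rs m p = 1}

/-- `𝓟 = {p : Y₁ ≥ 0, Y₂ ≥ 0, Y₃ ≥ 0}`. -/
def setP : Set (Fin 6 → ℝ) := {p | 0 ≤ p 3 ∧ 0 ≤ p 4 ∧ 0 ≤ p 5}

/-- `𝓐₁ = {p : X₁ ≤ X₂ and Y₁² ≤ 2}`. -/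
def setA1 : Set (Fin 6 → ℝ) := {p | p 0 ≤ p 1 ∧ (p 3)^2 ≤ 2}

/-- `𝓐₂`. -/
def setA2 : Set (Fin 6 → ℝ) :=
  {p | 0 ≤ 2*p 4 - p 5 ∧ 0 ≤ (Real.sqrt 2/2)*(2*p 4 - p 5) + p 2 - p 1 ∧
       p 1 ≤ 1/2 ∧ 0 ≤ p 2}

/-- The compact invariant set `𝓢`. -/
def setS (m : ℕ) : Set (Fin 6 → ℝ) := setE m ∩ setP ∩ setA1 ∩ setA2

/-- A solution of the Einstein ODE system on a set `I ⊆ ℝ`. -/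
def IsSolution (m : ℕ) (I : Set ℝ) (c : ℝ → Fin 6 → ℝ) : Prop :=
  ∀ η ∈ I, HasDerivWithinAt c (V m (c η)) I η

/-- A curve starting at zero whose derivative is bounded by a continuous multiple of its norm
vanishes identically. -/
theorem eq_zero_of_norm_deriv_le_mul_norm {E : Type*} [NormedAddCommGroup E] [NormedSpace ℝ E]
    {a b : ℝ} {z z' : ℝ → E} {k : ℝ → ℝ} (hk : ContinuousOn k (Icc a b))
    (hz : ∀ t ∈ Icc a b, HasDerivWithinAt z (z' t) (Icc a b) t)
    (hbound : ∀ t ∈ Icc a b, ‖z' t‖ ≤ k t * ‖z t‖) (ha : z a = 0) :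
    ∀ t ∈ Icc a b, z t = 0 := by
  obtain ⟨K, hK⟩ := isCompact_Icc.bddAbove_image hk
  refine eq_zero_of_abs_deriv_le_mul_abs_self_of_eq_zero_right (K := K) (f' := z')
    (fun t ht => (hz t ht).continuousWithinAt) (fun t ht => ?_) ha fun t ht => ?_
  · exact (hz t (Ico_subset_Icc_self ht)).mono_of_mem_nhdsWithin
      (Icc_mem_nhdsGE_of_mem ht)
  · exact (hbound t (Ico_subset_Icc_self ht)).trans (mul_le_mul_of_nonneg_right
      (hK (mem_image_of_mem k (Ico_subset_Icc_self ht))) (norm_nonneg _))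

theorem eq_zero_of_deriv_eq_mul_self {a b : ℝ} {y k : ℝ → ℝ} (hk : ContinuousOn k (Icc a b))
    (hy : ∀ t ∈ Icc a b, HasDerivWithinAt y (k t * y t) (Icc a b) t) (ha : y a = 0) :
    ∀ t ∈ Icc a b, y t = 0 :=
  eq_zero_of_norm_deriv_le_mul_norm hk.norm hy (fun _ _ => (norm_mul _ _).le) ha

/-- A solution of a scalar linear equation keeps its sign. -/
theorem nonneg_of_deriv_eq_mul_self {a b : ℝ} (hab : a ≤ b) {y k : ℝ → ℝ}
    (hk : ContinuousOn k (Icc a b))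
    (hy : ∀ t ∈ Icc a b, HasDerivWithinAt y (k t * y t) (Icc a b) t) (ha : 0 ≤ y a) :
    0 ≤ y b := by
  by_contra! hb
  obtain ⟨s, hs, hys⟩ := intermediate_value_Icc' hab
    (fun t ht => (hy t ht).continuousWithinAt) (show (0 : ℝ) ∈ Icc (y b) (y a) from ⟨hb.le, ha⟩)
  have hsub : Icc s b ⊆ Icc a b := Icc_subset_Icc_left hs.1
  exact hb.ne (eq_zero_of_deriv_eq_mul_self (hk.mono hsub)
    (fun t ht => (hy t (hsub ht)).mono hsub) hys b (right_mem_Icc.2 hs.2))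

theorem norm_linear_prod_le (p q r s x y : ℝ) :
    ‖(p * x + q * y, r * x + s * y)‖ ≤ ((|p| + |q|) + (|r| + |s|)) * ‖(x, y)‖ := by
  have hx : |x| ≤ ‖(x, y)‖ := norm_fst_le (x, y)
  have hy : |y| ≤ ‖(x, y)‖ := norm_snd_le (x, y)
  have row : ∀ u v : ℝ, |u * x + v * y| ≤ (|u| + |v|) * ‖(x, y)‖ := fun u v => by
    calc |u * x + v * y| ≤ |u| * |x| + |v| * |y| := by
          simpa only [abs_mul] using abs_add_le (u * x) (v * y)
      _ ≤ |u| * ‖(x, y)‖ + |v| * ‖(x, y)‖ := by gcongr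
      _ = _ := by ring
  rw [norm_prod_le_iff, add_mul]
  exact ⟨(row p q).trans (le_add_of_nonneg_right (by positivity)),
    (row r s).trans (le_add_of_nonneg_left (by positivity))⟩

theorem stmt15 (m : ℕ) (hm : 1 ≤ m) (I : Set ℝ) (hI : I.OrdConnected)
    (c : ℝ → Fin 6 → ℝ) (hc : IsSolution m I c)
    (η₀ η₁ : ℝ) (hη₀ : η₀ ∈ I) (hη₁ : η₁ ∈ I) (hle : η₀ ≤ η₁)
    (h0 : c η₀ ∈ setE m ∩ setP ∩ {p | 2*p 4 = p 5 ∧ p 1 = p 2}) :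
    c η₁ ∈ setE m ∩ setP ∩ {p | 2*p 4 = p 5 ∧ p 1 = p 2} := by
  have hsub : Icc η₀ η₁ ⊆ I := hI.out hη₀ hη₁
  have hd : ∀ i, ∀ t ∈ Icc η₀ η₁,
      HasDerivWithinAt (fun s => c s i) (V m (c t) i) (Icc η₀ η₁) t := fun i t ht =>
    hasDerivWithinAt_pi.1 ((hc t (hsub ht)).mono hsub) i
  have hcont : ∀ i, ContinuousOn (fun s => c s i) (Icc η₀ η₁) := fun i _ ht =>
    (hd i _ ht).continuousWithinAt
  have hc0 := hcont 0
  have hc1 := hcont 1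
  have hc2 := hcont 2
  have hc3 := hcont 3
  have hc4 := hcont 4
  have hc5 := hcont 5
  have hG : ContinuousOn (fun t => G m (c t)) (Icc η₀ η₁) := by
    unfold G; fun_prop
  have hR : ContinuousOn (fun t => Rs m (c t)) (Icc η₀ η₁) := by
    unfold Rs R1 R2 R3; fun_prop
  have hL : ContinuousOn (fun t => L m (c t)) (Icc η₀ η₁) := by
    unfold L; fun_prop
  have hright : η₁ ∈ Icc η₀ η₁ := right_mem_Icc.2 hle
  obtain ⟨⟨⟨hH, hE⟩, hY1, hY2, hY3⟩, hY, hX⟩ := h0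
  have key_H := eq_zero_of_deriv_eq_mul_self
    (y := fun t => c t 0 + 2 * c t 1 + 4 * (m : ℝ) * c t 2 - 1)
    (k := fun t => G m (c t) + L m (c t) - 1) (by fun_prop)
    (fun t ht => by
      refine ((((hd 0 t ht).add ((hd 1 t ht).const_mul 2)).add
        ((hd 2 t ht).const_mul (4 * (m : ℝ)))).sub_const 1).congr_deriv ?_
      have hLdef : (4 * (m : ℝ) + 2) * L m (c t) = G m (c t) + Rs m (c t) - 1 := by
        unfold L; field_simp
      simp only [V, Matrix.cons_val]
      unfold Rs at hLdef
      linear_combination -hLdef) (by simp [hH]) η₁ hright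
  have key_E := nonneg_of_deriv_eq_mul_self hle
    (y := fun t => 1 - (G m (c t) + Rs m (c t)))
    (k := fun t => 2 * (G m (c t) + L m (c t))
      + 2 * (1 - (c t 0 + 2 * c t 1 + 4 * (m : ℝ) * c t 2)) / (4 * (m : ℝ) + 2)) (by fun_prop)
    (fun t ht => by
      have d0 := hd 0 t ht
      have d1 := hd 1 t ht
      have d2 := hd 2 t ht
      have d3 := (hd 3 t ht).pow 2
      have d4 := hd 4 t ht
      have d5 := hd 5 t ht
      have dR1 := ((d3.const_mul (1 / 2)).mul (d4.pow 2)).add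
        ((d3.const_mul ((m : ℝ) / 4)).mul (d5.pow 2))
      have dR2 := (((d4.pow 2).const_mul 2).sub ((d3.const_mul (1 / 2)).mul (d4.pow 2))).add
        ((d5.pow 2).const_mul ((m : ℝ) / 2))
      have dR3 := (((d4.const_mul ((m : ℝ) + 2)).mul d5).sub
        ((d3.const_mul (1 / 8)).mul (d5.pow 2))).sub ((d5.pow 2).const_mul (1 / 2))
      have dG := ((d0.pow 2).add ((d1.pow 2).const_mul 2)).add
        ((d2.pow 2).const_mul (4 * (m : ℝ)))
      refine ((dG.add ((dR1.add (dR2.const_mul 2)).add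
        (dR3.const_mul (4 * (m : ℝ))))).const_sub 1).congr_deriv ?_
      have hdiv : ∀ H : ℝ, 2 * (1 - H) / (4 * (m : ℝ) + 2) * (1 - (G m (c t) + Rs m (c t)))
          = - 2 * (1 - H) * L m (c t) := fun H => by
        unfold L; field_simp; ring
      rw [add_mul (2 * (G m (c t) + L m (c t))), hdiv]
      simp only [V, Matrix.cons_val, Pi.pow_apply]
      generalize L m (c t) = l
      simp only [G, Rs, R1, R2, R3]
      push_cast
      ring) (by simpa using hE)
  have key_Y1 := nonneg_of_deriv_eq_mul_self hle
    (y := fun t => c t 3) (k := fun t => c t 0 - c t 1) (by fun_prop)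
    (fun t ht => by
      refine (hd 3 t ht).congr_deriv ?_
      simp only [V, Matrix.cons_val]; ring) hY1
  have key_Y2 := nonneg_of_deriv_eq_mul_self hle
    (y := fun t => c t 4) (k := fun t => G m (c t) + L m (c t) - c t 1) (by fun_prop)
    (fun t ht => by
      refine (hd 4 t ht).congr_deriv ?_
      simp only [V, Matrix.cons_val]; ring) hY2
  have key_Y3 := nonneg_of_deriv_eq_mul_self hle
    (y := fun t => c t 5) (k := fun t => G m (c t) + L m (c t) + c t 1 - 2 * c t 2) (by fun_prop)
    (fun t ht => by
      refine (hd 5 t ht).congr_deriv ?_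
      simp only [V, Matrix.cons_val]; ring) hY3
  have key_FS := eq_zero_of_norm_deriv_le_mul_norm
    (z := fun t => (2 * c t 4 - c t 5, c t 1 - c t 2))
    (z' := fun t =>
      ((G m (c t) + L m (c t) - c t 1) * (2 * c t 4 - c t 5)
          + (-2 * c t 5) * (c t 1 - c t 2),
        (c t 4 - ((m : ℝ) + 1) / 2 * c t 5 - 1 / 8 * (c t 3) ^ 2 * (2 * c t 4 + c t 5))
            * (2 * c t 4 - c t 5)
          + (G m (c t) + L m (c t) - 1) * (c t 1 - c t 2)))
    (k := fun t => (|G m (c t) + L m (c t) - c t 1| + |-2 * c t 5|)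
      + (|c t 4 - ((m : ℝ) + 1) / 2 * c t 5 - 1 / 8 * (c t 3) ^ 2 * (2 * c t 4 + c t 5)|
        + |G m (c t) + L m (c t) - 1|)) (by fun_prop)
    (fun t ht => by
      refine ((((hd 4 t ht).const_mul 2).sub (hd 5 t ht)).prodMk
        ((hd 1 t ht).sub (hd 2 t ht))).congr_deriv ?_
      simp only [V, Matrix.cons_val, R2, R3]
      ext <;> simp only <;> ring)
    (fun _ _ => norm_linear_prod_le _ _ _ _ _ _)
    (by simp only [Prod.mk_eq_zero]; exact ⟨sub_eq_zero.2 hY, sub_eq_zero.2 hX⟩) η₁ hright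
  rw [Prod.mk_eq_zero] at key_FS
  exact ⟨⟨⟨sub_eq_zero.1 key_H, sub_nonneg.1 key_E⟩, key_Y1, key_Y2, key_Y3⟩,
    sub_eq_zero.1 key_FS.1, sub_eq_zero.1 key_FS.2⟩

end
end

section
/- The Kähler–Einstein set 𝓑_{KE} = 𝓔 ∩ 𝓟 ∩ {p : 2Y₂ = Y₃, X₂ = X₃, and X₃ = (1/4)Y₁Y₃} is forward flow-invariant for the Einstein vector field: if c : I → ℝ⁶ is a solution of c'(η) = V(c(η)) on an interval I, η₀, η₁ ∈ I with η₀ ≤ η₁, and c(η₀) ∈ 𝓑_{KE}, then c(η₁) ∈ 𝓑_{KE}. -/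
open Real Set Filter

noncomputable section

/-- Differential inequality comparison: a function with `f' ≤ a f` that starts nonpositive
stays nonpositive. -/
theorem nonpos_of_deriv_le_mul {s t : ℝ} (hst : s ≤ t) {f f' a : ℝ → ℝ}
    (ha : ContinuousOn a (Icc s t))
    (hf : ∀ x ∈ Icc s t, HasDerivWithinAt f (f' x) (Icc s t) x)
    (hle : ∀ x ∈ Icc s t, f' x ≤ a x * f x) (hs : f s ≤ 0) : f t ≤ 0 := by
  set b : ℝ → ℝ := IccExtend hst ((Icc s t).domRestrict a) with hb
  have hbc : Continuous b := (continuousOn_iff_continuous_domRestrict.mp ha).Icc_extend'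
  have hba : ∀ x ∈ Icc s t, b x = a x := fun x hx => by
    rw [hb, IccExtend_of_mem hst _ hx]; rfl
  set A : ℝ → ℝ := fun x => ∫ y in s..x, b y with hA
  have hAd : ∀ x, HasDerivAt A (b x) x := fun x => hbc.integral_hasStrictDerivAt s x |>.hasDerivAt
  have hg : ∀ x ∈ Icc s t, HasDerivWithinAt (fun y => f y * Real.exp (-A y))
      (f' x * Real.exp (-A x) + f x * (Real.exp (-A x) * -b x)) (Icc s t) x := fun x hx =>
    (hf x hx).mul ((hAd x).neg.exp.hasDerivWithinAt)
  have hanti : AntitoneOn (fun y => f y * Real.exp (-A y)) (Icc s t) := by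
    refine antitoneOn_of_hasDerivWithinAt_nonpos (convex_Icc s t)
      (fun x hx => (hg x hx).continuousWithinAt)
      (fun x hx => (hg x (interior_subset hx)).mono interior_subset) fun x hx => ?_
    have hx' := interior_subset hx
    have h1 := hle x hx'
    rw [hba x hx']
    nlinarith [mul_le_mul_of_nonneg_right h1 (Real.exp_pos (-A x)).le]
  have h := hanti (left_mem_Icc.mpr hst) (right_mem_Icc.mpr hst) hst
  simp only at h
  have h2 : f t * Real.exp (-A t) ≤ 0 :=
    h.trans (mul_nonpos_of_nonpos_of_nonneg hs (Real.exp_pos _).le)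
  exact nonpos_of_mul_nonpos_left h2 (Real.exp_pos _)

/-- A solution of a scalar homogeneous linear equation `f' = a f` that starts at zero
stays zero. -/
theorem eq_zero_of_deriv_eq_mul {s t : ℝ} (hst : s ≤ t) {f f' a : ℝ → ℝ}
    (ha : ContinuousOn a (Icc s t))
    (hf : ∀ x ∈ Icc s t, HasDerivWithinAt f (f' x) (Icc s t) x)
    (heq : ∀ x ∈ Icc s t, f' x = a x * f x) (hs : f s = 0) : f t = 0 := by
  refine le_antisymm (nonpos_of_deriv_le_mul hst ha hf (fun x hx => (heq x hx).le) hs.le) ?_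
  have := nonpos_of_deriv_le_mul (f := fun x => -f x) hst ha (fun x hx => (hf x hx).neg)
    (fun x hx => by rw [heq x hx]; exact (mul_neg _ _).ge) (by simp [hs])
  linarith

/-- A solution of a planar homogeneous linear system that starts at zero stays zero. -/
theorem eq_zero_of_planar_linear {s t : ℝ} (hst : s ≤ t) {u v u' v' a₁ a₂ b₁ b₂ : ℝ → ℝ}
    (ha₁ : ContinuousOn a₁ (Icc s t)) (ha₂ : ContinuousOn a₂ (Icc s t))
    (hb₁ : ContinuousOn b₁ (Icc s t)) (hb₂ : ContinuousOn b₂ (Icc s t))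
    (hu : ∀ x ∈ Icc s t, HasDerivWithinAt u (u' x) (Icc s t) x)
    (hv : ∀ x ∈ Icc s t, HasDerivWithinAt v (v' x) (Icc s t) x)
    (hu' : ∀ x ∈ Icc s t, u' x = a₁ x * u x + a₂ x * v x)
    (hv' : ∀ x ∈ Icc s t, v' x = b₁ x * u x + b₂ x * v x)
    (hus : u s = 0) (hvs : v s = 0) : u t = 0 ∧ v t = 0 := by
  have h : u t ^ 2 + v t ^ 2 ≤ 0 := by
    refine nonpos_of_deriv_le_mul (f := fun x => u x ^ 2 + v x ^ 2)
      (a := fun x => 2 * |a₁ x| + 2 * |b₂ x| + |a₂ x + b₁ x|) hst (by fun_prop)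
      (fun x hx => ((hu x hx).pow 2).add ((hv x hx).pow 2)) (fun x hx => ?_) (by simp [hus, hvs])
    rw [hu' x hx, hv' x hx]
    have h1 := mul_le_mul_of_nonneg_right (le_abs_self (a₁ x)) (sq_nonneg (u x))
    have h2 := mul_le_mul_of_nonneg_right (le_abs_self (b₂ x)) (sq_nonneg (v x))
    have h3 : (a₂ x + b₁ x) * (2 * u x * v x) ≤ |a₂ x + b₁ x| * (u x ^ 2 + v x ^ 2) := by
      refine (le_abs_self _).trans ?_
      rw [abs_mul]
      refine mul_le_mul_of_nonneg_left (abs_le.mpr ⟨?_, ?_⟩) (abs_nonneg _)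
      · nlinarith [sq_nonneg (u x + v x)]
      · nlinarith [sq_nonneg (u x - v x)]
    have h4 := mul_nonneg (abs_nonneg (a₁ x)) (sq_nonneg (v x))
    have h5 := mul_nonneg (abs_nonneg (b₂ x)) (sq_nonneg (u x))
    norm_num
    linarith
  constructor <;> nlinarith [sq_nonneg (u t), sq_nonneg (v t)]

theorem continuous_G (m : ℕ) : Continuous (G m) := by unfold G; fun_prop

theorem continuous_L (m : ℕ) : Continuous (L m) := by unfold L G Rs R1 R2 R3; fun_prop

theorem stmt16 (m : ℕ) (hm : 1 ≤ m) (I : Set ℝ) (hI : I.OrdConnected)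
    (c : ℝ → Fin 6 → ℝ) (hc : IsSolution m I c)
    (η₀ η₁ : ℝ) (hη₀ : η₀ ∈ I) (hη₁ : η₁ ∈ I) (hle : η₀ ≤ η₁)
    (h0 : c η₀ ∈ setE m ∩ setP ∩
      {p | 2*p 4 = p 5 ∧ p 1 = p 2 ∧ p 2 = (1/4)*p 3*p 5}) :
    c η₁ ∈ setE m ∩ setP ∩
      {p | 2*p 4 = p 5 ∧ p 1 = p 2 ∧ p 2 = (1/4)*p 3*p 5} := by
  obtain ⟨⟨⟨hH0, hW0⟩, hY10, hY20, hY30⟩, hu0, hv0, hw0⟩ := h0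
  have hsub : Icc η₀ η₁ ⊆ I := hI.out hη₀ hη₁
  have hd : ∀ x ∈ Icc η₀ η₁, ∀ i,
      HasDerivWithinAt (fun y => c y i) (V m (c x) i) (Icc η₀ η₁) x := fun x hx i =>
    hasDerivWithinAt_pi.mp ((hc x (hsub hx)).mono hsub) i
  have hcc : ContinuousOn c (Icc η₀ η₁) := fun x hx =>
    ((hc x (hsub hx)).mono hsub).continuousWithinAt
  have hcoef : ∀ {a : (Fin 6 → ℝ) → ℝ}, Continuous a → ∀ x ∈ Icc η₀ η₁,
      ContinuousOn (fun y => a (c y)) (Icc η₀ x) := fun ha x hx =>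
    ha.comp_continuousOn (hcc.mono (Icc_subset_Icc_right hx.2))
  have hGc := continuous_G m
  have hLc := continuous_L m
  have hX1 := fun x hx => hd x hx 0
  have hX2 := fun x hx => hd x hx 1
  have hX3 := fun x hx => hd x hx 2
  have hY1 := fun x hx => hd x hx 3
  have hY2 := fun x hx => hd x hx 4
  have hY3 := fun x hx => hd x hx 5
  simp only [V, Matrix.cons_val] at hX1 hX2 hX3 hY1 hY2 hY3
  have hmono : ∀ x ∈ Icc η₀ η₁, Icc η₀ x ⊆ Icc η₀ η₁ := fun x hx => Icc_subset_Icc_right hx.2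
  have hL : ∀ p, (4 * (m : ℝ) + 2) * L m p = G m p + Rs m p - 1 := fun p => by
    unfold L; field_simp
  have hH : ∀ x ∈ Icc η₀ η₁, c x 0 + 2 * c x 1 + 4 * (m : ℝ) * c x 2 - 1 = 0 := fun x hx =>
    eq_zero_of_deriv_eq_mul (f := fun y => c y 0 + 2 * c y 1 + 4 * (m : ℝ) * c y 2 - 1) hx.1
      (hcoef (a := fun p => G m p + L m p - 1) (by fun_prop) x hx)
      (fun y hy => ((((hX1 y (hmono x hx hy)).add ((hX2 y (hmono x hx hy)).const_mul 2)).add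
        ((hX3 y (hmono x hx hy)).const_mul (4 * (m : ℝ)))).sub_const 1).mono (hmono x hx))
      (fun y _ => by
        have := hL (c y)
        simp only [Rs] at this
        linear_combination -this)
      (sub_eq_zero.mpr hH0)
  have huv : ∀ x ∈ Icc η₀ η₁, 2 * c x 4 - c x 5 = 0 ∧ c x 1 - c x 2 = 0 := fun x hx =>
    eq_zero_of_planar_linear (u := fun y => 2 * c y 4 - c y 5) (v := fun y => c y 1 - c y 2) hx.1
      (hcoef (a := fun p => G m p + L m p - p 1) (by fun_prop) x hx)
      (hcoef (a := fun p => -2 * p 5) (by fun_prop) x hx)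
      (hcoef (a := fun p => (1/2) * (2 * p 4 - p 5) - (m : ℝ) / 2 * p 5
        - (1/8) * (p 3)^2 * (2 * p 4 + p 5)) (by fun_prop) x hx)
      (hcoef (a := fun p => G m p + L m p - 1) (by fun_prop) x hx)
      (fun y hy => (((hY2 y (hmono x hx hy)).const_mul 2).sub
        (hY3 y (hmono x hx hy))).mono (hmono x hx))
      (fun y hy => ((hX2 y (hmono x hx hy)).sub (hX3 y (hmono x hx hy))).mono (hmono x hx))
      (fun y _ => by ring)
      (fun y _ => by simp only [R2, R3]; ring)
      (sub_eq_zero.mpr hu0) (sub_eq_zero.mpr hv0)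
  have hw : c η₁ 2 - (1/4) * c η₁ 3 * c η₁ 5 = 0 := by
    refine eq_zero_of_deriv_eq_mul (f := fun y => c y 2 - (1/4) * c y 3 * c y 5) hle
      (hcoef (a := fun p => G m p + L m p + p 0 - p 2 + (1/4) * p 3 * p 5) (by fun_prop) η₁
        (right_mem_Icc.mpr hle))
      (fun y hy => (hX3 y hy).sub (((hY1 y hy).const_mul (1/4)).mul (hY3 y hy)))
      (fun y hy => ?_) (sub_eq_zero.mpr hw0)
    have hLy := hL (c y)
    have h0 : c y 0 = 1 - (4 * m + 2) * c y 2 := by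
      linear_combination hH y hy - 2 * (huv y hy).2
    have h1 : c y 1 = c y 2 := sub_eq_zero.mp (huv y hy).2
    have h5 : c y 5 = 2 * c y 4 := (sub_eq_zero.mp (huv y hy).1).symm
    have hLy' : L m (c y) = -c y 2 * (2 - (4 * m + 2) * c y 2) + (c y 2)^2
        - (1/4) * (c y 3)^2 * (c y 4)^2 + (2 * m + 2) * (c y 4)^2 := by
      have hm2 : (4 * (m : ℝ) + 2) ≠ 0 := by positivity
      apply mul_left_cancel₀ hm2
      rw [hLy]
      simp only [G, Rs, R1, R2, R3, h0, h1, h5]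
      ring
    simp only [R3, hLy', h0, h1, h5]
    ring
  have hW : G m (c η₁) + Rs m (c η₁) - 1 ≤ 0 := by
    have hGd : ∀ y ∈ Icc η₀ η₁, HasDerivWithinAt (fun y => G m (c y) + Rs m (c y) - 1)
        (2 * (G m (c y) + L m (c y)) * (G m (c y) + Rs m (c y) - 1)) (Icc η₀ η₁) y := by
      intro y hy
      have x1 := (hX1 y hy).pow 2
      have x2 := (hX2 y hy).pow 2
      have x3 := (hX3 y hy).pow 2
      have y1 := (hY1 y hy).pow 2
      have y2 := (hY2 y hy).pow 2
      have y3 := (hY3 y hy).pow 2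
      have y23 := (hY2 y hy).mul (hY3 y hy)
      have r1 := ((y1.mul y2).const_mul (1/2)).add ((y1.mul y3).const_mul ((m : ℝ)/4))
      have r2 := ((y2.const_mul 2).sub ((y1.mul y2).const_mul (1/2))).add
        (y3.const_mul ((m : ℝ)/2))
      have r3 := ((y23.const_mul ((m : ℝ)+2)).sub ((y1.mul y3).const_mul (1/8))).sub
        (y3.const_mul (1/2))
      have key := (((x1.add (x2.const_mul 2)).add (x3.const_mul (4*(m : ℝ)))).add
        ((r1.add (r2.const_mul 2)).add (r3.const_mul (4*(m : ℝ))))).sub_const 1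
      refine (key.congr_of_mem (fun z _ => ?_) hy).congr_deriv ?_
      · simp only [G, Rs, R1, R2, R3, Pi.add_apply, Pi.sub_apply, Pi.mul_apply, Pi.pow_apply]
        ring
      · simp only [Pi.pow_apply]
        generalize L m (c y) = l
        generalize hg : G m (c y) = g
        have hg' := hg
        simp only [G] at hg'
        simp only [Rs, R1, R2, R3]
        push_cast
        linear_combination (2 * g + 2 * l - 2) * hg' - 2 * l * hH y hy
    exact nonpos_of_deriv_le_mul hle
      (hcoef (a := fun p => 2 * (G m p + L m p)) (by fun_prop) η₁ (right_mem_Icc.mpr hle))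
      hGd (fun y _ => le_rfl) (sub_nonpos.mpr hW0)
  have hY : ∀ {i : Fin 6} {a : (Fin 6 → ℝ) → ℝ}, Continuous a → (∀ p, V m p i = p i * a p) →
      0 ≤ c η₀ i → 0 ≤ c η₁ i := fun {i a} ha hV hi => by
    have := nonpos_of_deriv_le_mul (f := fun y => -c y i) hle
      (hcoef ha η₁ (right_mem_Icc.mpr hle)) (fun y hy => (hd y hy i).neg)
      (fun y _ => by rw [hV]; exact (by ring : -(c y i * a (c y)) = a (c y) * -c y i).le)
      (neg_nonpos.mpr hi)
    exact neg_nonpos.mp this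
  have hη := right_mem_Icc.mpr hle
  refine ⟨⟨⟨sub_eq_zero.mp (hH η₁ hη), sub_nonpos.mp hW⟩, ?_, ?_, ?_⟩,
    sub_eq_zero.mp (huv η₁ hη).1, sub_eq_zero.mp (huv η₁ hη).2, sub_eq_zero.mp hw⟩
  · exact hY (i := 3) (a := fun p => p 0 - p 1) (by fun_prop) (fun p => rfl) hY10
  · exact hY (i := 4) (a := fun p => G m p + L m p - p 1) (by fun_prop) (fun p => rfl) hY20
  · exact hY (i := 5) (a := fun p => G m p + L m p + p 1 - 2 * p 2) (by fun_prop)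
      (fun p => rfl) hY30

end
end

section
/- The quaternionic Kähler set 𝓑_{QK} = 𝓔 ∩ 𝓟 ∩ {p : X₁ = X₂, Y₁² = 2, Y₃² − 2Y₂Y₃ + (2/(m+3))·L = 0, and X₃ = (1/4)Y₁Y₃} is forward flow-invariant for the Einstein vector field: if c : I → ℝ⁶ is a solution of c'(η) = V(c(η)) on an interval I, η₀, η₁ ∈ I with η₀ ≤ η₁, and c(η₀) ∈ 𝓑_{QK}, then c(η₁) ∈ 𝓑_{QK}. -/
open Real Set Filter

noncomputable section

theorem linear_pair_eq_zero {a b : ℝ} {f g k₁₁ k₁₂ k₂₁ k₂₂ : ℝ → ℝ}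
    (h₁₁ : ContinuousOn k₁₁ (Icc a b)) (h₁₂ : ContinuousOn k₁₂ (Icc a b))
    (h₂₁ : ContinuousOn k₂₁ (Icc a b)) (h₂₂ : ContinuousOn k₂₂ (Icc a b))
    (hf : ∀ t ∈ Icc a b, HasDerivWithinAt f (k₁₁ t * f t + k₁₂ t * g t) (Icc a b) t)
    (hg : ∀ t ∈ Icc a b, HasDerivWithinAt g (k₂₁ t * f t + k₂₂ t * g t) (Icc a b) t)
    (hfa : f a = 0) (hga : g a = 0) : ∀ t ∈ Icc a b, f t = 0 ∧ g t = 0 := by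
  obtain ⟨C₁₁, hC₁₁⟩ := isCompact_Icc.exists_bound_of_continuousOn h₁₁
  obtain ⟨C₁₂, hC₁₂⟩ := isCompact_Icc.exists_bound_of_continuousOn h₁₂
  obtain ⟨C₂₁, hC₂₁⟩ := isCompact_Icc.exists_bound_of_continuousOn h₂₁
  obtain ⟨C₂₂, hC₂₂⟩ := isCompact_Icc.exists_bound_of_continuousOn h₂₂
  have hd : ∀ t ∈ Icc a b, HasDerivWithinAt (fun s => (f s, g s))
      (k₁₁ t * f t + k₁₂ t * g t, k₂₁ t * f t + k₂₂ t * g t) (Icc a b) t :=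
    fun t ht => (hf t ht).prodMk (hg t ht)
  have row : ∀ {x y u v C D : ℝ}, ‖x‖ ≤ C → ‖y‖ ≤ D →
      ‖x * u + y * v‖ ≤ (C + D) * ‖(u, v)‖ := by
    intro x y u v C D hx hy
    have hu : ‖u‖ ≤ ‖(u, v)‖ := norm_fst_le (u, v)
    have hv : ‖v‖ ≤ ‖(u, v)‖ := norm_snd_le (u, v)
    calc ‖x * u + y * v‖ ≤ ‖x‖ * ‖u‖ + ‖y‖ * ‖v‖ := by
          simpa only [norm_mul] using norm_add_le (x * u) (y * v)
      _ ≤ C * ‖(u, v)‖ + D * ‖(u, v)‖ := by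
          gcongr
          · exact (norm_nonneg x).trans hx
          · exact (norm_nonneg y).trans hy
      _ = (C + D) * ‖(u, v)‖ := by ring
  have key := norm_le_gronwallBound_of_norm_deriv_right_le (δ := 0) (ε := 0)
    (K := max (C₁₁ + C₁₂) (C₂₁ + C₂₂)) (fun t ht => (hd t ht).continuousWithinAt)
    (fun t ht => (hd t ⟨ht.1, ht.2.le⟩).mono_of_mem_nhdsWithin (Icc_mem_nhdsGE_of_mem ht))
    (by simp [hfa, hga]) (fun t ht => by
      have ht' : t ∈ Icc a b := ⟨ht.1, ht.2.le⟩
      rw [add_zero]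
      refine (norm_prod_le_iff).2 ⟨?_, ?_⟩
      · exact (row (hC₁₁ t ht') (hC₁₂ t ht')).trans
          (mul_le_mul_of_nonneg_right (le_max_left _ _) (norm_nonneg _))
      · exact (row (hC₂₁ t ht') (hC₂₂ t ht')).trans
          (mul_le_mul_of_nonneg_right (le_max_right _ _) (norm_nonneg _)))
  intro t ht
  have h := key t ht
  rw [gronwallBound_ε0_δ0, norm_le_zero_iff] at h
  exact Prod.mk_eq_zero.1 h

theorem linear_eq_zero {a b : ℝ} {f k : ℝ → ℝ} (hk : ContinuousOn k (Icc a b))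
    (hf : ∀ t ∈ Icc a b, HasDerivWithinAt f (k t * f t) (Icc a b) t)
    (hfa : f a = 0) : ∀ t ∈ Icc a b, f t = 0 := fun t ht =>
  (linear_pair_eq_zero (g := fun _ => 0) (k₁₂ := fun _ => 0) (k₂₁ := fun _ => 0)
    (k₂₂ := fun _ => 0) hk continuousOn_const continuousOn_const continuousOn_const
    (fun t ht => by simpa using hf t ht)
    (fun t _ => by simpa using hasDerivWithinAt_const t (Icc a b) (0 : ℝ)) hfa rfl t ht).1

theorem linear_nonneg {a b : ℝ} {f k : ℝ → ℝ} (hk : ContinuousOn k (Icc a b))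
    (hf : ∀ t ∈ Icc a b, HasDerivWithinAt f (k t * f t) (Icc a b) t)
    (hfa : 0 ≤ f a) : ∀ t ∈ Icc a b, 0 ≤ f t := by
  intro t ht
  by_contra! hneg
  have hsub : Icc a t ⊆ Icc a b := Icc_subset_Icc_right ht.2
  obtain ⟨s, hs, hs0⟩ := intermediate_value_Icc' ht.1
    (fun u hu => ((hf u (hsub hu)).continuousWithinAt.mono hsub)) ⟨hneg.le, hfa⟩
  have hsub' : Icc s b ⊆ Icc a b := Icc_subset_Icc_left hs.1
  exact hneg.ne (linear_eq_zero (hk.mono hsub') (fun u hu => (hf u (hsub' hu)).mono hsub')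
    hs0 t ⟨hs.2, ht.2⟩)

theorem mul_L_eq (m : ℕ) (p : Fin 6 → ℝ) :
    (4 * (m : ℝ) + 2) * L m p = G m p + Rs m p - 1 := by
  have : (4 * (m : ℝ) + 2) ≠ 0 := by positivity
  rw [L]; field_simp

theorem hasDerivWithinAt_L {m : ℕ} {c : ℝ → Fin 6 → ℝ} {J : Set ℝ} {t : ℝ}
    (h : HasDerivWithinAt c (V m (c t)) J t)
    (hH : c t 0 + 2 * c t 1 + 4 * (m : ℝ) * c t 2 = 1) :
    HasDerivWithinAt (fun s => L m (c s)) (2 * (G m (c t) + L m (c t)) * L m (c t)) J t := by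
  have hpi := hasDerivWithinAt_pi.1 h
  have h0 := hpi 0
  have h1 := hpi 1
  have h2 := hpi 2
  have h3 := hpi 3
  have h4 := hpi 4
  have h5 := hpi 5
  have hG := ((h0.fun_pow 2).fun_add ((h1.fun_pow 2).const_mul 2)).fun_add
    ((h2.fun_pow 2).const_mul (4 * (m : ℝ)))
  have hR1 := (((h3.fun_pow 2).const_mul (1 / 2)).fun_mul (h4.fun_pow 2)).fun_add
    (((h3.fun_pow 2).const_mul ((m : ℝ) / 4)).fun_mul (h5.fun_pow 2))
  have hR2 := (((h4.fun_pow 2).const_mul 2).fun_sub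
    (((h3.fun_pow 2).const_mul (1 / 2)).fun_mul (h4.fun_pow 2))).fun_add
    ((h5.fun_pow 2).const_mul ((m : ℝ) / 2))
  have hR3 := (((h4.const_mul ((m : ℝ) + 2)).fun_mul h5).fun_sub
    (((h3.fun_pow 2).const_mul (1 / 8)).fun_mul (h5.fun_pow 2))).fun_sub
    ((h5.fun_pow 2).const_mul (1 / 2))
  have hL := ((hG.fun_add ((hR1.fun_add (hR2.const_mul 2)).fun_add
    (hR3.const_mul (4 * (m : ℝ))))).sub_const 1).div_const (4 * (m : ℝ) + 2)
  refine hL.congr_deriv ?_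
  have hm : (4 * (m : ℝ) + 2) ≠ 0 := by positivity
  rw [div_eq_iff hm]
  have hLm := mul_L_eq m (c t)
  simp only [V, Fin.isValue, Matrix.cons_val]
  generalize L m (c t) = l at *
  simp only [Rs, R1, R2, R3, G] at *
  linear_combination (-2 * l) * hH -
    2 * (c t 0 ^ 2 + 2 * c t 1 ^ 2 + 4 * (m : ℝ) * c t 2 ^ 2 + l) * hLm

/-- With `X₃ = Y₁Y₃/4`, the vanishing of this function cuts out the component of the quaternionic
Kähler set along which the flow moves. -/
def movingDefect (m : ℕ) (p : Fin 6 → ℝ) : ℝ := 3 * p 4 - (2 * (m : ℝ) + 3) * p 5 + p 3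

/-- The other linear factor of the quadratic equation defining the quaternionic Kähler set; on `𝓔`
it vanishes only at a stationary point. -/
def fixedDefect (m : ℕ) (p : Fin 6 → ℝ) : ℝ := 3 * p 4 - (4 * (m : ℝ) + 3) * p 5 - p 3

def shearDefect (p : Fin 6 → ℝ) : ℝ := p 2 - p 3 * p 5 / 4

/-- The coefficient of `shearDefect` in the expansion of `L`. -/
def shearCoeff (m : ℕ) (p : Fin 6 → ℝ) : ℝ :=
  -8 * (m : ℝ) / 3 + (16 * (m : ℝ) ^ 2 / 3 + 4 * m) * (p 2 + p 3 * p 5 / 4)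

theorem continuous_fixedDefect (m : ℕ) : Continuous (fixedDefect m) := by
  unfold fixedDefect; fun_prop

theorem continuous_shearCoeff (m : ℕ) : Continuous (shearCoeff m) := by
  unfold shearCoeff; fun_prop

section Algebra

variable {m : ℕ} {p : Fin 6 → ℝ}

theorem L_eq_of_defects
    (hH : p 0 + 2 * p 1 + 4 * (m : ℝ) * p 2 = 1) (hX : p 0 = p 1) (hY : p 3 ^ 2 = 2) :
    L m p = ((m : ℝ) + 3) / 2 * (2 * p 4 * p 5 - p 5 ^ 2) +
      (shearDefect p * shearCoeff m p + movingDefect m p * fixedDefect m p / 3) /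
        (4 * (m : ℝ) + 2) := by
  have hm : (4 * (m : ℝ) + 2) ≠ 0 := by positivity
  have h1 : p 1 = (1 - 4 * (m : ℝ) * p 2) / 3 := by linarith
  apply mul_left_cancel₀ hm
  rw [mul_L_eq, mul_add, mul_div_cancel₀ _ hm]
  simp only [shearCoeff, shearDefect, movingDefect, fixedDefect, Rs, R1, R2, R3, G, hX, h1]
  linear_combination (-(p 4) ^ 2 / 2 - (m : ℝ) / 4 * p 5 ^ 2 + 1 / 3 +
    p 5 ^ 2 * ((m : ℝ) ^ 2 / 3 + m / 4)) * hY

theorem shearDefect_deriv_eq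
    (hH : p 0 + 2 * p 1 + 4 * (m : ℝ) * p 2 = 1) (hX : p 0 = p 1) (hY : p 3 ^ 2 = 2) :
    V m p 2 - (V m p 3 * p 5 + p 3 * V m p 5) / 4 =
      (G m p + L m p - 1 + p 3 * p 5 * (2 * (m : ℝ) + 3) / 6 -
        shearCoeff m p / (4 * (m : ℝ) + 2)) * shearDefect p +
      (-(p 5) / 3 - fixedDefect m p / 3 / (4 * (m : ℝ) + 2)) * movingDefect m p := by
  have h1 : p 1 = (1 - 4 * (m : ℝ) * p 2) / 3 := by linarith
  have hL := L_eq_of_defects hH hX hY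
  simp only [V, Matrix.cons_val, R3, hX, h1]
  simp only [shearDefect, movingDefect] at *
  linear_combination (p 5 ^ 2 * (m : ℝ) / 12) * hY - hL

theorem movingDefect_deriv_eq
    (hH : p 0 + 2 * p 1 + 4 * (m : ℝ) * p 2 = 1) (hX : p 0 = p 1) (hY : p 3 ^ 2 = 2) :
    3 * V m p 4 - (2 * (m : ℝ) + 3) * V m p 5 + V m p 3 =
      (p 3 * (4 / 3 * ((m : ℝ) + 3) * ((4 * (m : ℝ) + 3) * (p 3 * p 5 / 4 + p 2) - 1) +
        4 * (2 * (m : ℝ) + 3) * (p 1 - p 2)) -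
        p 3 * shearCoeff m p / (4 * (m : ℝ) + 2)) * shearDefect p +
      (G m p + L m p - p 1 - p 3 * ((m : ℝ) + 3) / 3 * p 5 -
        p 3 * fixedDefect m p / 3 / (4 * (m : ℝ) + 2)) * movingDefect m p := by
  have h1 : p 1 = (1 - 4 * (m : ℝ) * p 2) / 3 := by linarith
  have hL := L_eq_of_defects hH hX hY
  simp only [V, Matrix.cons_val, G, hX, h1]
  simp only [shearDefect, movingDefect] at *
  linear_combination (p 3 * ((m : ℝ) + 3) * (4 * (m : ℝ) + 3) / 12 * p 5 ^ 2 +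
    (2 * (m : ℝ) + 3) * p 5 * ((1 - 4 * (m : ℝ) * p 2) / 3 - p 2)) * hY - p 3 * hL

end Algebra

theorem stmt17 (m : ℕ) (hm : 1 ≤ m) (I : Set ℝ) (hI : I.OrdConnected)
    (c : ℝ → Fin 6 → ℝ) (hc : IsSolution m I c)
    (η₀ η₁ : ℝ) (hη₀ : η₀ ∈ I) (hη₁ : η₁ ∈ I) (hle : η₀ ≤ η₁)
    (h0 : c η₀ ∈ setE m ∩ setP ∩
      {p | p 0 = p 1 ∧ (p 3)^2 = 2 ∧
           (p 5)^2 - 2*p 4*p 5 + (2/((m:ℝ)+3))*L m p = 0 ∧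
           p 2 = (1/4)*p 3*p 5}) :
    c η₁ ∈ setE m ∩ setP ∩
      {p | p 0 = p 1 ∧ (p 3)^2 = 2 ∧
           (p 5)^2 - 2*p 4*p 5 + (2/((m:ℝ)+3))*L m p = 0 ∧
           p 2 = (1/4)*p 3*p 5} := by
  obtain ⟨⟨⟨hH0, hE0⟩, hP3, hP4, hP5⟩, hX0, hY0, hQ0, hR0⟩ := h0
  have hm0 : (0 : ℝ) < 4 * (m : ℝ) + 2 := by positivity
  have hsub : Icc η₀ η₁ ⊆ I := hI.out hη₀ hη₁
  have hd : ∀ t ∈ Icc η₀ η₁, HasDerivWithinAt c (V m (c t)) (Icc η₀ η₁) t :=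
    fun t ht => (hc t (hsub ht)).mono hsub
  have hcc : ContinuousOn c (Icc η₀ η₁) := fun t ht => (hd t ht).continuousWithinAt
  have hdi : ∀ i, ∀ t ∈ Icc η₀ η₁,
      HasDerivWithinAt (fun s => c s i) (V m (c t) i) (Icc η₀ η₁) t :=
    fun i t ht => hasDerivWithinAt_pi.1 (hd t ht) i
  have hcomp : ∀ {k : (Fin 6 → ℝ) → ℝ}, Continuous k →
      ContinuousOn (fun t => k (c t)) (Icc η₀ η₁) := fun hk => hk.comp_continuousOn hcc
  have hGc := continuous_G m
  have hLc := continuous_L m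
  have hSc := continuous_shearCoeff m
  have hFc := continuous_fixedDefect m
  have hend : η₁ ∈ Icc η₀ η₁ := ⟨hle, le_rfl⟩
  have hstart : η₀ ∈ Icc η₀ η₁ := ⟨le_rfl, hle⟩
  have hH : ∀ t ∈ Icc η₀ η₁, c t 0 + 2 * c t 1 + 4 * (m : ℝ) * c t 2 - 1 = 0 := by
    refine linear_eq_zero (hcomp (k := fun p => G m p + L m p - 1) (by fun_prop))
      (fun t ht => ?_) (by linarith)
    refine ((((hdi 0 t ht).fun_add ((hdi 1 t ht).const_mul 2)).fun_add
      ((hdi 2 t ht).const_mul (4 * (m : ℝ)))).sub_const 1).congr_deriv ?_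
    have hLm := mul_L_eq m (c t)
    simp only [V, Matrix.cons_val, Rs] at *
    linear_combination -hLm
  have hXY : ∀ t ∈ Icc η₀ η₁, c t 0 - c t 1 = 0 ∧ c t 3 ^ 2 - 2 = 0 := by
    refine linear_pair_eq_zero (k₂₂ := fun _ => 0)
      (hcomp (k := fun p => G m p + L m p - 1) (by fun_prop))
      (hcomp (k := fun p => p 4 ^ 2 + m / 4 * p 5 ^ 2) (by fun_prop))
      (hcomp (k := fun p => 2 * p 3 ^ 2) (by fun_prop)) continuousOn_const
      (fun t ht => ?_) (fun t ht => ?_) (by linarith) (by linarith)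
    · refine ((hdi 0 t ht).fun_sub (hdi 1 t ht)).congr_deriv ?_
      simp only [V, Matrix.cons_val, R1, R2]
      ring
    · refine (((hdi 3 t ht).fun_pow 2).sub_const 2).congr_deriv ?_
      simp only [V, Matrix.cons_val]
      push_cast
      ring
  have h3 : ∀ t ∈ Icc η₀ η₁, 0 ≤ c t 3 :=
    linear_nonneg (hcomp (k := fun p => p 0 - p 1) (by fun_prop))
      (fun t ht => (hdi 3 t ht).congr_deriv (by simp only [V, Matrix.cons_val]; ring)) hP3
  have h4 : ∀ t ∈ Icc η₀ η₁, 0 ≤ c t 4 :=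
    linear_nonneg (hcomp (k := fun p => G m p + L m p - p 1) (by fun_prop))
      (fun t ht => (hdi 4 t ht).congr_deriv (by simp only [V, Matrix.cons_val]; ring)) hP4
  have hc5 : ContinuousOn (fun t => G m (c t) + L m (c t) + c t 1 - 2 * c t 2) (Icc η₀ η₁) :=
    hcomp (k := fun p => G m p + L m p + p 1 - 2 * p 2) (by fun_prop)
  have hd5 : ∀ t ∈ Icc η₀ η₁, HasDerivWithinAt (fun s => c s 5)
      ((G m (c t) + L m (c t) + c t 1 - 2 * c t 2) * c t 5) (Icc η₀ η₁) t :=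
    fun t ht => (hdi 5 t ht).congr_deriv (by simp only [V, Matrix.cons_val]; ring)
  have h5 : ∀ t ∈ Icc η₀ η₁, 0 ≤ c t 5 := linear_nonneg hc5 hd5 hP5
  have hcL : ContinuousOn (fun t => 2 * (G m (c t) + L m (c t))) (Icc η₀ η₁) :=
    hcomp (k := fun p => 2 * (G m p + L m p)) (by fun_prop)
  have hdL : ∀ t ∈ Icc η₀ η₁, HasDerivWithinAt (fun s => L m (c s))
      (2 * (G m (c t) + L m (c t)) * L m (c t)) (Icc η₀ η₁) t :=
    fun t ht => hasDerivWithinAt_L (hd t ht) (by linarith [hH t ht])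
  have hL0 : L m (c η₀) ≤ 0 := div_nonpos_of_nonpos_of_nonneg (by linarith) hm0.le
  have hL : ∀ t ∈ Icc η₀ η₁, 0 ≤ -L m (c t) :=
    linear_nonneg hcL (fun t ht => (hdL t ht).fun_neg.congr_deriv (by ring)) (by linarith)
  have hQL : c η₀ 5 ^ 2 - 2 * c η₀ 4 * c η₀ 5 = -(2 / ((m : ℝ) + 3) * L m (c η₀)) := by
    linarith
  have hprod : movingDefect m (c η₀) * fixedDefect m (c η₀) = 0 := by
    have h := L_eq_of_defects hH0 hX0 hY0
    have hr : shearDefect (c η₀) = 0 := by rw [shearDefect]; linarith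
    have hq : ((m : ℝ) + 3) / 2 * (2 * c η₀ 4 * c η₀ 5 - c η₀ 5 ^ 2) = L m (c η₀) := by
      have : 2 * c η₀ 4 * c η₀ 5 - c η₀ 5 ^ 2 = 2 / ((m : ℝ) + 3) * L m (c η₀) := by linarith
      rw [this]
      field_simp
    rw [hr, hq] at h
    have h' : (0 * shearCoeff m (c η₀) + movingDefect m (c η₀) * fixedDefect m (c η₀) / 3) /
        (4 * (m : ℝ) + 2) = 0 := by linarith
    rcases div_eq_zero_iff.1 h' with h' | h'
    · linarith
    · exact absurd h' hm0.ne'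
  have hfinal : c η₁ 2 = 1 / 4 * c η₁ 3 * c η₁ 5 ∧
      c η₁ 5 ^ 2 - 2 * c η₁ 4 * c η₁ 5 + 2 / ((m : ℝ) + 3) * L m (c η₁) = 0 := by
    rcases mul_eq_zero.1 hprod with hs | hA
    · have hrs : ∀ t ∈ Icc η₀ η₁, shearDefect (c t) = 0 ∧ movingDefect m (c t) = 0 := by
        refine linear_pair_eq_zero
          (hcomp (k := fun p => G m p + L m p - 1 + p 3 * p 5 * (2 * (m : ℝ) + 3) / 6 -
            shearCoeff m p / (4 * (m : ℝ) + 2)) (by fun_prop))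
          (hcomp (k := fun p => -(p 5) / 3 - fixedDefect m p / 3 / (4 * (m : ℝ) + 2))
            (by fun_prop))
          (hcomp (k := fun p => p 3 * (4 / 3 * ((m : ℝ) + 3) *
            ((4 * (m : ℝ) + 3) * (p 3 * p 5 / 4 + p 2) - 1) +
            4 * (2 * (m : ℝ) + 3) * (p 1 - p 2)) -
            p 3 * shearCoeff m p / (4 * (m : ℝ) + 2)) (by fun_prop))
          (hcomp (k := fun p => G m p + L m p - p 1 - p 3 * ((m : ℝ) + 3) / 3 * p 5 -
            p 3 * fixedDefect m p / 3 / (4 * (m : ℝ) + 2)) (by fun_prop))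
          (fun t ht => ?_) (fun t ht => ?_) (by rw [shearDefect]; linarith) hs
        · exact ((hdi 2 t ht).fun_sub (((hdi 3 t ht).fun_mul (hdi 5 t ht)).div_const 4)).congr_deriv
            (shearDefect_deriv_eq (by linarith [hH t ht]) (by linarith [(hXY t ht).1])
              (by linarith [(hXY t ht).2]))
        · exact ((((hdi 4 t ht).const_mul 3).fun_sub
            ((hdi 5 t ht).const_mul (2 * (m : ℝ) + 3))).fun_add (hdi 3 t ht)).congr_deriv
            (movingDefect_deriv_eq (by linarith [hH t ht]) (by linarith [(hXY t ht).1])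
              (by linarith [(hXY t ht).2]))
      obtain ⟨hr1, hs1⟩ := hrs η₁ hend
      have h := L_eq_of_defects (m := m) (p := c η₁) (by linarith [hH η₁ hend])
        (by linarith [(hXY η₁ hend).1]) (by linarith [(hXY η₁ hend).2])
      rw [hr1, hs1] at h
      rw [shearDefect] at hr1
      refine ⟨by linarith, ?_⟩
      rw [h]
      field_simp
      ring
    · have h50 : c η₀ 5 = 0 := by
        have hq : 0 ≤ c η₀ 5 ^ 2 - 2 * c η₀ 4 * c η₀ 5 := by
          rw [hQL, ← mul_neg]
          exact mul_nonneg (by positivity) (by linarith)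
        have h4e : c η₀ 4 = ((4 * (m : ℝ) + 3) * c η₀ 5 + c η₀ 3) / 3 := by
          rw [fixedDefect] at hA; linarith
        rw [h4e] at hq
        have := mul_nonneg hP3 hP5
        have := mul_nonneg (Nat.cast_nonneg (α := ℝ) m) (sq_nonneg (c η₀ 5))
        have : c η₀ 5 ^ 2 ≤ 0 := by nlinarith
        exact pow_eq_zero_iff two_ne_zero |>.1 (le_antisymm this (sq_nonneg _))
      have h5z := linear_eq_zero hc5 hd5 h50
      have hLz0 : L m (c η₀) = 0 := by
        rw [h50] at hQ0
        have : (2 / ((m : ℝ) + 3)) ≠ 0 := by positivity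
        exact (mul_eq_zero.1 (by linarith : 2 / ((m : ℝ) + 3) * L m (c η₀) = 0)).resolve_left this
      have hLz := linear_eq_zero hcL hdL hLz0
      have h2z : ∀ t ∈ Icc η₀ η₁, c t 2 = 0 := by
        refine linear_eq_zero (hcomp (k := fun p => G m p + L m p - 1) (by fun_prop))
          (fun t ht => (hdi 2 t ht).congr_deriv ?_) (by rw [hR0, h50, mul_zero])
        simp only [V, Matrix.cons_val, R3, h5z t ht, hLz t ht]
        ring
      rw [h5z η₁ hend, hLz η₁ hend, h2z η₁ hend]
      simp
  refine ⟨⟨⟨by linarith [hH η₁ hend], ?_⟩, h3 η₁ hend, h4 η₁ hend, h5 η₁ hend⟩,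
    by linarith [(hXY η₁ hend).1], by linarith [(hXY η₁ hend).2], hfinal.2, hfinal.1⟩
  have := mul_L_eq m (c η₁)
  have := mul_nonneg hm0.le (hL η₁ hend)
  linarith

end
end

section
/- Let c : [0, ∞) → ℝ⁶ be a solution of c'(η) = V(c(η)) such that for every η ≥ 0 the point c(η) satisfies X₁ + 2X₂ + 4m·X₃ = 1, R_s(c(η)) ≥ 0 and G(c(η)) + R_s(c(η)) ≤ 1, and suppose G(c(0)) + R_s(c(0)) < 1. Then the integral ∫₀^∞ √(1 − G(c(η)) − R_s(c(η))) dη diverges to infinity; consequently, the arclength parameter t = ∫ W dη of the corresponding cohomogeneity-one Einstein metric tends to infinity, so the metric is defined on all of (0, ∞). -/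
open Real Set Filter

noncomputable section

/-- Along a solution in the hyperplane `X₁ + 2X₂ + 4m X₃ = 1`, the defect `1 - G - R_s`
satisfies the linear equation `Q' = 2 Q (G + L)`. -/
theorem IsSolution.hasDerivWithinAt_defect {m : ℕ} {I : Set ℝ} {c : ℝ → Fin 6 → ℝ}
    (hc : IsSolution m I c) {η : ℝ} (hη : η ∈ I)
    (htr : c η 0 + 2 * c η 1 + 4 * (m : ℝ) * c η 2 = 1) :
    HasDerivWithinAt (fun t => 1 - G m (c t) - Rs m (c t))
      (2 * (1 - G m (c η) - Rs m (c η)) * (G m (c η) + L m (c η))) I η := by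
  have h := hasDerivWithinAt_pi.mp (hc η hη)
  have h₀ := h 0
  have h₁ := h 1
  have h₂ := h 2
  have h₃ := h 3
  have h₄ := h 4
  have h₅ := h 5
  have hG : HasDerivWithinAt (fun t => G m (c t)) _ I η :=
    ((h₀.pow 2).add ((h₁.pow 2).const_mul 2)).add ((h₂.pow 2).const_mul (4 * (m : ℝ)))
  have hR₁ : HasDerivWithinAt (fun t => R1 m (c t)) _ I η :=
    (((h₃.pow 2).const_mul (1 / 2)).mul (h₄.pow 2)).add
      (((h₃.pow 2).const_mul ((m : ℝ) / 4)).mul (h₅.pow 2))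
  have hR₂ : HasDerivWithinAt (fun t => R2 m (c t)) _ I η :=
    (((h₄.pow 2).const_mul 2).sub (((h₃.pow 2).const_mul (1 / 2)).mul (h₄.pow 2))).add
      ((h₅.pow 2).const_mul ((m : ℝ) / 2))
  have hR₃ : HasDerivWithinAt (fun t => R3 m (c t)) _ I η :=
    (((h₄.const_mul ((m : ℝ) + 2)).mul h₅).sub
      (((h₃.pow 2).const_mul (1 / 8)).mul (h₅.pow 2))).sub ((h₅.pow 2).const_mul (1 / 2))
  have hRs : HasDerivWithinAt (fun t => Rs m (c t)) _ I η :=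
    (hR₁.add (hR₂.const_mul 2)).add (hR₃.const_mul (4 * (m : ℝ)))
  refine (((hasDerivWithinAt_const η I (1 : ℝ)).sub hG).sub hRs).congr_deriv ?_
  have hV₀ : V m (c η) 0 = c η 0 * (G m (c η) + L m (c η) - 1) + R1 m (c η) - L m (c η) := rfl
  have hV₁ : V m (c η) 1 = c η 1 * (G m (c η) + L m (c η) - 1) + R2 m (c η) - L m (c η) := rfl
  have hV₂ : V m (c η) 2 = c η 2 * (G m (c η) + L m (c η) - 1) + R3 m (c η) - L m (c η) := rfl
  have hV₃ : V m (c η) 3 = c η 3 * (c η 0 - c η 1) := rfl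
  have hV₄ : V m (c η) 4 = c η 4 * (G m (c η) + L m (c η) - c η 1) := rfl
  have hV₅ : V m (c η) 5 = c η 5 * (G m (c η) + L m (c η) + c η 1 - 2 * c η 2) := rfl
  simp only [hV₀, hV₁, hV₂, hV₃, hV₄, hV₅, Pi.pow_apply]
  have hx : c η 0 = 1 - 2 * c η 1 - 4 * (m : ℝ) * c η 2 := by linarith
  generalize L m (c η) = l
  simp only [G, Rs, R1, R2, R3, hx]
  push_cast
  ring

/-- By the Cauchy–Schwarz inequality, `G + L ≥ 0` wherever the trace is `1` and `R_s ≥ 0`. -/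
theorem G_add_L_nonneg {m : ℕ} {p : Fin 6 → ℝ}
    (htr : p 0 + 2 * p 1 + 4 * (m : ℝ) * p 2 = 1) (hRs : 0 ≤ Rs m p) :
    0 ≤ G m p + L m p := by
  have hm : (0 : ℝ) ≤ m := m.cast_nonneg
  have hG : 1 ≤ (4 * (m : ℝ) + 3) * G m p := by
    have hid : (4 * (m : ℝ) + 3) * G m p - (p 0 + 2 * p 1 + 4 * (m : ℝ) * p 2) ^ 2
        = 2 * (p 0 - p 1) ^ 2 + 4 * m * (p 0 - p 2) ^ 2 + 8 * m * (p 1 - p 2) ^ 2 := by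
      simp only [G]; ring
    have hsum : 0 ≤ 2 * (p 0 - p 1) ^ 2 + 4 * m * (p 0 - p 2) ^ 2
        + 8 * m * (p 1 - p 2) ^ 2 := by positivity
    rw [htr] at hid
    linarith
  have hGL : G m p + L m p = ((4 * (m : ℝ) + 3) * G m p - 1 + Rs m p) / (4 * m + 2) := by
    simp only [L]; field_simp; ring
  rw [hGL]
  apply div_nonneg <;> linarith

theorem stmt19 (m : ℕ) (hm : 1 ≤ m) (c : ℝ → Fin 6 → ℝ)
    (hc : IsSolution m (Set.Ici 0) c)
    (hcon : ∀ η ∈ Set.Ici (0:ℝ),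
      (c η) 0 + 2*(c η) 1 + 4*(m:ℝ)*(c η) 2 = 1 ∧
      0 ≤ Rs m (c η) ∧ G m (c η) + Rs m (c η) ≤ 1)
    (h0 : G m (c 0) + Rs m (c 0) < 1) :
    Filter.Tendsto
      (fun T => ∫ η in Set.Icc (0:ℝ) T, Real.sqrt (1 - G m (c η) - Rs m (c η)))
      Filter.atTop Filter.atTop := by
  set Q : ℝ → ℝ := fun η => 1 - G m (c η) - Rs m (c η) with hQ
  have hderiv : ∀ η ∈ Ici (0 : ℝ), HasDerivWithinAt Q
      (2 * (1 - G m (c η) - Rs m (c η)) * (G m (c η) + L m (c η))) (Ici 0) η :=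
    fun η hη => hc.hasDerivWithinAt_defect hη (hcon η hη).1
  have hcont : ContinuousOn Q (Ici 0) := fun η hη => (hderiv η hη).continuousWithinAt
  have hmono : MonotoneOn Q (Ici 0) := by
    refine monotoneOn_of_hasDerivWithinAt_nonneg (convex_Ici 0) hcont
      (fun η hη => (hderiv η (interior_subset hη)).mono interior_subset) fun η hη => ?_
    obtain ⟨htr, hRs, hle⟩ := hcon η (interior_subset hη)
    exact mul_nonneg (by linarith) (G_add_L_nonneg htr hRs)
  have hpos : 0 < √(Q 0) := Real.sqrt_pos.mpr (by simp only [hQ]; linarith)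
  refine tendsto_atTop_mono' atTop ?_ (tendsto_id.atTop_mul_const hpos)
  filter_upwards [eventually_ge_atTop 0] with T hT
  have hint : MeasureTheory.IntegrableOn (fun η => √(Q η)) (Icc 0 T) :=
    (hcont.mono Icc_subset_Ici_self).sqrt.integrableOn_Icc
  calc id T * √(Q 0) = ∫ _ in Icc 0 T, √(Q 0) := by simp [hT]
    _ ≤ ∫ η in Icc 0 T, √(Q η) :=
      MeasureTheory.setIntegral_mono_on (by simp) hint measurableSet_Icc
        fun η hη => Real.sqrt_le_sqrt (hmono self_mem_Ici hη.1 hη.1)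

end
end
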